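/- X-free LTL formulas are invariant under stuttering: let φ be an LTL formula containing no X operator (built from propositions using ¬, ∧, ∨, F, G, U), let σ : ℕ → 2^PROP be a word, let j ∈ ℕ, and let σ' be the word obtained by duplicating position j of σ, i.e., σ'(i) = σ(i) for i ≤ j and σ'(i) = σ(i−1) for i > j. Then σ ⊨ φ if and only if σ' ⊨ φ. -/

import Mathlib

inductive LTL (P : Type) : Type
  | atom : P → LTL P
  | neg  : LTL P → LTL P
  | conj : LTL P → LTL P → LTL P
  | disj : LTL P → LTL P → LTL P
  | next : LTL P → LTL P
  | fut  : LTL P → LTL P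
  | glob : LTL P → LTL P
  | untl : LTL P → LTL P → LTL P

structure Kripke (P W : Type) where
  R : W → W → Prop
  V : W → Set P

/-- Totality of the transition relation: every world has a successor. -/
def Kripke.Total {P W : Type} (A : Kripke P W) : Prop := ∀ w, ∃ w', A.R w w'

/-- A path in a Kripke structure. -/
def IsPath {P W : Type} (A : Kripke P W) (π : ℕ → W) : Prop := ∀ i, A.R (π i) (π (i + 1))

/-- LTL satisfaction over a Kripke structure and a path. -/
def Sat {P W : Type} (A : Kripke P W) : LTL P → (ℕ → W) → Prop
  | .atom p, π => p ∈ A.V (π 0)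
  | .neg φ, π => ¬ Sat A φ π
  | .conj φ ψ, π => Sat A φ π ∧ Sat A ψ π
  | .disj φ ψ, π => Sat A φ π ∨ Sat A ψ π
  | .next φ, π => Sat A φ (fun i => π (i + 1))
  | .fut φ, π => ∃ k, Sat A φ (fun i => π (k + i))
  | .glob φ, π => ∀ k, Sat A φ (fun i => π (k + i))
  | .untl φ ψ, π => ∃ k, Sat A ψ (fun i => π (k + i)) ∧ ∀ j < k, Sat A φ (fun i => π (j + i))

/-- Word satisfaction: the same clauses, with a word `σ : ℕ → Set P` in place of a path. -/
def WSat {P : Type} : LTL P → (ℕ → Set P) → Prop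
  | .atom p, σ => p ∈ σ 0
  | .neg φ, σ => ¬ WSat φ σ
  | .conj φ ψ, σ => WSat φ σ ∧ WSat ψ σ
  | .disj φ ψ, σ => WSat φ σ ∨ WSat ψ σ
  | .next φ, σ => WSat φ (fun i => σ (i + 1))
  | .fut φ, σ => ∃ k, WSat φ (fun i => σ (k + i))
  | .glob φ, σ => ∀ k, WSat φ (fun i => σ (k + i))
  | .untl φ ψ, σ => ∃ k, WSat ψ (fun i => σ (k + i)) ∧ ∀ j < k, WSat φ (fun i => σ (j + i))

/-- X-free LTL formulas: no `next` operator occurs. -/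
def NoX {P : Type} : LTL P → Prop
  | .atom _ => True
  | .neg φ => NoX φ
  | .conj φ ψ => NoX φ ∧ NoX ψ
  | .disj φ ψ => NoX φ ∧ NoX ψ
  | .next _ => False
  | .fut φ => NoX φ
  | .glob φ => NoX φ
  | .untl φ ψ => NoX φ ∧ NoX ψ

theorem stutter_key {P : Type} (φ : LTL P)
    (ih : ∀ (σ : ℕ → Set P) (j : ℕ),
      WSat φ σ ↔ WSat φ (fun i => if i ≤ j then σ i else σ (i - 1)))
    (σ : ℕ → Set P) (j k : ℕ) :
    WSat φ (fun i => if k + i ≤ j then σ (k + i) else σ (k + i - 1)) ↔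
      WSat φ (fun i => σ ((if k ≤ j then k else k - 1) + i)) := by
  by_cases hk : k ≤ j
  · rw [if_pos hk, ih (fun i => σ (k + i)) (j - k)]
    have : (fun i => if k + i ≤ j then σ (k + i) else σ (k + i - 1)) =
        (fun i => if i ≤ j - k then σ (k + i) else σ (k + (i - 1))) := by
      funext i
      by_cases h : k + i ≤ j
      · rw [if_pos h, if_pos (by omega)]
      · rw [if_neg h, if_neg (by omega)]
        congr 1
        omega
    rw [this]
  · rw [if_neg hk]
    have : (fun i => if k + i ≤ j then σ (k + i) else σ (k + i - 1)) =
        (fun i => σ (k - 1 + i)) := by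
      funext i
      rw [if_neg (by omega)]
      congr 1
      omega
    rw [this]

theorem stutter_rs (j k : ℕ) :
    (if (if k ≤ j then k else k + 1) ≤ j then (if k ≤ j then k else k + 1)
      else (if k ≤ j then k else k + 1) - 1) = k := by
  split_ifs <;> omega

theorem stutter_all {P : Type} (φ : LTL P) (hφ : NoX φ) : ∀ (σ : ℕ → Set P) (j : ℕ),
    WSat φ σ ↔ WSat φ (fun i => if i ≤ j then σ i else σ (i - 1)) := by
  induction φ with
  | atom p => intro σ j; simp [WSat]
  | neg φ ih => intro σ j; exact not_congr (ih hφ σ j)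
  | conj φ ψ ih1 ih2 => intro σ j; exact and_congr (ih1 hφ.1 σ j) (ih2 hφ.2 σ j)
  | disj φ ψ ih1 ih2 => intro σ j; exact or_congr (ih1 hφ.1 σ j) (ih2 hφ.2 σ j)
  | next φ ih => exact hφ.elim
  | fut φ ih =>
    intro σ j
    simp only [WSat, stutter_key φ (ih hφ)]
    constructor
    · rintro ⟨k, hk⟩
      refine ⟨if k ≤ j then k else k + 1, ?_⟩
      rwa [stutter_rs]
    · rintro ⟨k, hk⟩
      exact ⟨_, hk⟩
  | glob φ ih =>
    intro σ j
    simp only [WSat, stutter_key φ (ih hφ)]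
    constructor
    · intro h k
      exact h _
    · intro h k
      have := h (if k ≤ j then k else k + 1)
      rwa [stutter_rs] at this
  | untl φ ψ ih1 ih2 =>
    intro σ j
    simp only [WSat, stutter_key φ (ih1 hφ.1), stutter_key ψ (ih2 hφ.2)]
    constructor
    · rintro ⟨k, hk, h⟩
      refine ⟨if k ≤ j then k else k + 1, ?_, ?_⟩
      · rwa [stutter_rs]
      · intro i hi
        apply h
        split_ifs at hi ⊢ <;> omega
    · rintro ⟨k, hk, h⟩
      refine ⟨_, hk, ?_⟩
      intro i hi
      have := h (if i ≤ j then i else i + 1) (by split_ifs at hi ⊢ <;> omega)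
      rwa [stutter_rs] at this

/-- X-free LTL formulas are invariant under stuttering (duplicating position `j`). -/
theorem noX_stutter_invariant {P : Type} [Countable P] (φ : LTL P) (hφ : NoX φ)
    (σ : ℕ → Set P) (j : ℕ) :
    WSat φ σ ↔ WSat φ (fun i => if i ≤ j then σ i else σ (i - 1)) := by
  exact stutter_all φ hφ σ j
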